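/- Let n ≥ 4 and let a, b ∈ B_n be half-twists (conjugates of σ_1). For any nonzero integers j and k, the powers a^j and b^k commute if and only if a and b commute. -/

import Mathlib

/-- Relators for the braid group with generators `σ_0, …, σ_{m-1}`:
the braid relations `σ_i σ_j σ_i = σ_j σ_i σ_j` for `j = i+1`, and the
commutation relations `σ_i σ_j = σ_j σ_i` for `j ≥ i+2`. -/
def braidRels (m : ℕ) : Set (FreeGroup (Fin m)) :=
  { r | ∃ i j : Fin m,
      ((i : ℕ) + 1 = (j : ℕ) ∧
        r = FreeGroup.of i * FreeGroup.of j * FreeGroup.of i *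
            (FreeGroup.of j * FreeGroup.of i * FreeGroup.of j)⁻¹) ∨
      ((i : ℕ) + 2 ≤ (j : ℕ) ∧
        r = FreeGroup.of i * FreeGroup.of j * (FreeGroup.of j * FreeGroup.of i)⁻¹) }

/-- The braid group on `n` strands: the presented group with generators
`σ_1, …, σ_{n-1}` (indexed by `Fin (n-1)`) and the braid relators. -/
abbrev BraidGroup (n : ℕ) : Type := PresentedGroup (braidRels (n - 1))

/-- The standard generator `σ_{i+1}` of the braid group (0-indexed). -/
def braidσ (n : ℕ) (i : Fin (n - 1)) : BraidGroup n := PresentedGroup.of i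

/-- The element `δ = σ_1 σ_2 ⋯ σ_{n-1}` of the braid group. -/
def braidδ (n : ℕ) : BraidGroup n := (List.ofFn (braidσ n)).prod

/-- The full twist `z = (σ_1 σ_2 ⋯ σ_{n-1})^n`. -/
def fullTwist (n : ℕ) : BraidGroup n := braidδ n ^ n

/-- Two generator indices are adjacent when the generators satisfy the braid relation. -/
def BraidNear {m : ℕ} (i j : Fin m) : Prop :=
  (i : ℕ) + 1 = j ∨ (j : ℕ) + 1 = i

/-- Two generator indices are far apart when the generators commute. -/
def BraidFar {m : ℕ} (i j : Fin m) : Prop :=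
  (i : ℕ) + 2 ≤ j ∨ (j : ℕ) + 2 ≤ i

theorem BraidNear.symm {m : ℕ} {i j : Fin m} (h : BraidNear i j) : BraidNear j i := Or.symm h

theorem BraidFar.symm {m : ℕ} {i j : Fin m} (h : BraidFar i j) : BraidFar j i := Or.symm h

theorem eq_or_braidFar_or_braidNear {m : ℕ} (i j : Fin m) :
    i = j ∨ BraidFar i j ∨ BraidNear i j := by
  unfold BraidFar BraidNear
  omega

/-- The relations of the positive braid monoid with generators indexed by `Fin m`. -/
inductive BraidMonoidRel (m : ℕ) : FreeMonoid (Fin m) → FreeMonoid (Fin m) → Prop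
  | braid (i j : Fin m) (h : BraidNear i j) : BraidMonoidRel m
      (FreeMonoid.of i * FreeMonoid.of j * FreeMonoid.of i)
      (FreeMonoid.of j * FreeMonoid.of i * FreeMonoid.of j)
  | comm (i j : Fin m) (h : BraidFar i j) : BraidMonoidRel m
      (FreeMonoid.of i * FreeMonoid.of j) (FreeMonoid.of j * FreeMonoid.of i)

/-- The positive braid monoid with generators indexed by `Fin m`. -/
abbrev BraidMonoid (m : ℕ) : Type := PresentedMonoid (BraidMonoidRel m)

namespace BraidMonoid

variable {m : ℕ}

/-- The standard generators of the positive braid monoid. -/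
def s (i : Fin m) : BraidMonoid m := PresentedMonoid.of _ i

theorem s_mul_s {i j : Fin m} (h : BraidFar i j) : s i * s j = s j * s i :=
  PresentedMonoid.mk_eq_mk_of_rel (BraidMonoidRel.comm i j h)

theorem s_mul_s_mul_s {i j : Fin m} (h : BraidNear i j) :
    s i * (s j * s i) = s j * (s i * s j) := by
  rw [← mul_assoc, ← mul_assoc]
  exact PresentedMonoid.mk_eq_mk_of_rel (BraidMonoidRel.braid i j h)

theorem far_comm {i j : Fin m} (h : BraidFar i j) (x : BraidMonoid m) :
    s i * (s j * x) = s j * (s i * x) := by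
  rw [← mul_assoc, s_mul_s h, mul_assoc]

theorem near_braid {i j : Fin m} (h : BraidNear i j) (x : BraidMonoid m) :
    s i * (s j * (s i * x)) = s j * (s i * (s j * x)) := by
  simpa only [mul_assoc] using congrArg (· * x) (s_mul_s_mul_s h)

@[elab_as_elim]
theorem induction_s {C : BraidMonoid m → Prop} (x : BraidMonoid m) (one : C 1)
    (s_mul : ∀ i x, C x → C (s i * x)) : C x := by
  obtain ⟨w, rfl⟩ := PresentedMonoid.surjective_mk x
  induction w using FreeMonoid.inductionOn' with
  | one => exact one
  | of_mul i w ih => exact s_mul i _ ih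

/-- Word length, as a monoid homomorphism. -/
def lenHom (m : ℕ) : BraidMonoid m →* Multiplicative ℕ :=
  PresentedMonoid.lift (fun _ => Multiplicative.ofAdd 1) (by
    rintro _ _ (⟨i, j, h⟩ | ⟨i, j, h⟩) <;> rfl)

/-- Word length in the positive braid monoid. -/
def len (x : BraidMonoid m) : ℕ := (lenHom m x).toAdd

@[simp] theorem len_one : len (1 : BraidMonoid m) = 0 := by simp [len]

@[simp] theorem len_mul (x y : BraidMonoid m) : len (x * y) = len x + len y := by simp [len]

@[simp] theorem len_s (i : Fin m) : len (s i) = 1 := rfl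

theorem len_mk_of_mul (i : Fin m) (u : FreeMonoid (Fin m)) :
    len (PresentedMonoid.mk (BraidMonoidRel m) (FreeMonoid.of i * u)) =
      len (PresentedMonoid.mk (BraidMonoidRel m) u) + 1 := by
  rw [map_mul, len_mul, add_comm]
  rfl

/-- `HeadRel i u j v` says that the equality `s i * u = s j * v` is explained by the least common
multiple of the generators `s i` and `s j`. -/
def HeadRel (i : Fin m) (u : BraidMonoid m) (j : Fin m) (v : BraidMonoid m) : Prop :=
  (i = j ∧ u = v) ∨
  (BraidFar i j ∧ ∃ w, u = s j * w ∧ v = s i * w) ∨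
  (BraidNear i j ∧ ∃ w, u = s j * (s i * w) ∧ v = s i * (s j * w))

theorem HeadRel.symm {i j : Fin m} {u v : BraidMonoid m} (h : HeadRel i u j v) :
    HeadRel j v i u := by
  rcases h with ⟨rfl, rfl⟩ | ⟨hf, w, hu, hv⟩ | ⟨hn, w, hu, hv⟩
  · exact .inl ⟨rfl, rfl⟩
  · exact .inr (.inl ⟨hf.symm, w, hv, hu⟩)
  · exact .inr (.inr ⟨hn.symm, w, hv, hu⟩)

theorem HeadRel.mul_right {i j : Fin m} {u v : BraidMonoid m} (h : HeadRel i u j v)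
    (x : BraidMonoid m) : HeadRel i (u * x) j (v * x) := by
  rcases h with ⟨rfl, rfl⟩ | ⟨hf, w, rfl, rfl⟩ | ⟨hn, w, rfl, rfl⟩
  · exact .inl ⟨rfl, rfl⟩
  · exact .inr (.inl ⟨hf, w * x, by simp only [mul_assoc], by simp only [mul_assoc]⟩)
  · exact .inr (.inr ⟨hn, w * x, by simp only [mul_assoc], by simp only [mul_assoc]⟩)

theorem HeadRel.eq {i : Fin m} {u v : BraidMonoid m} (h : HeadRel i u i v) : u = v := by
  rcases h with ⟨_, h⟩ | ⟨h, _⟩ | ⟨h, _⟩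
  · exact h
  · unfold BraidFar at h; omega
  · unfold BraidNear at h; omega

theorem HeadRel.of_far {i j : Fin m} {u v : BraidMonoid m} (h : HeadRel i u j v)
    (hf : BraidFar i j) : ∃ w, u = s j * w ∧ v = s i * w := by
  rcases h with ⟨rfl, _⟩ | ⟨_, h⟩ | ⟨h, _⟩
  · unfold BraidFar at hf; omega
  · exact h
  · unfold BraidFar at hf; unfold BraidNear at h; omega

theorem HeadRel.of_near {i j : Fin m} {u v : BraidMonoid m} (h : HeadRel i u j v)
    (hn : BraidNear i j) : ∃ w, u = s j * (s i * w) ∧ v = s i * (s j * w) := by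
  rcases h with ⟨rfl, _⟩ | ⟨h, _⟩ | ⟨_, h⟩
  · unfold BraidNear at hn; omega
  · unfold BraidNear at hn; unfold BraidFar at h; omega
  · exact h

/-- The least common multiple property for equalities between products of a generator with an
element of length less than `L`. -/
def HeadRelBelow (m L : ℕ) : Prop :=
  ∀ (i j : Fin m) (p q : BraidMonoid m), len p < L → s i * p = s j * q → HeadRel i p j q

/-- Transitivity through a middle generator, one far and one near: the one composite case in
which all three rank-two configurations can occur. -/
theorem HeadRelBelow.trans_far_near {L : ℕ} (ih : HeadRelBelow m L) {i k j : Fin m}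
    {u w v : BraidMonoid m} (hw : len w ≤ L) (hik : BraidFar i k) (hkj : BraidNear k j)
    (h₁ : HeadRel i u k w) (h₂ : HeadRel k w j v) : HeadRel i u j v := by
  obtain ⟨p, rfl, rfl⟩ := h₁.of_far hik
  obtain ⟨q, hq, rfl⟩ := h₂.of_near hkj
  have hl := congrArg len hq
  simp only [len_mul, len_s] at hw hl
  have h := ih _ _ _ _ (by omega) hq
  rcases eq_or_braidFar_or_braidNear i j with rfl | hij | hij
  · unfold BraidFar at hik; unfold BraidNear at hkj; omega
  · obtain ⟨r, rfl, hr⟩ := h.of_far hij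
    have hl' := congrArg len hr
    simp only [len_mul, len_s] at hw hl hl'
    obtain ⟨t, rfl, rfl⟩ := (ih _ _ _ _ (by omega) hr).of_far hik.symm
    exact .inr (.inl ⟨hij, s k * (s j * t), near_braid hkj _, by
      rw [far_comm hij.symm, far_comm hik.symm]⟩)
  · obtain ⟨r, rfl, hr⟩ := h.of_near hij
    have hl' := congrArg len hr
    simp only [len_mul, len_s] at hw hl hl'
    obtain ⟨t, rfl, ht⟩ := (ih _ _ _ _ (by omega) hr).of_far hik.symm
    have hl'' := congrArg len ht
    simp only [len_mul, len_s] at hw hl hl' hl''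
    obtain ⟨x, rfl, rfl⟩ := (ih _ _ _ _ (by omega) ht).of_near hkj.symm
    refine .inr (.inr ⟨hij, s k * (s j * (s i * x)), ?_, ?_⟩)
    · rw [far_comm hik (s j * x), near_braid hkj, near_braid hij.symm, far_comm hik.symm]
    · rw [near_braid hij.symm, far_comm hik.symm (s j * _), far_comm hik x, near_braid hkj]

theorem HeadRelBelow.trans {L : ℕ} (ih : HeadRelBelow m L) {i k j : Fin m}
    {u w v : BraidMonoid m} (hw : len w ≤ L)
    (h₁ : HeadRel i u k w) (h₂ : HeadRel k w j v) : HeadRel i u j v := by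
  rcases eq_or_braidFar_or_braidNear i k with rfl | hik | hik
  · rwa [h₁.eq]
  · rcases eq_or_braidFar_or_braidNear k j with rfl | hkj | hkj
    · rwa [← h₂.eq]
    · obtain ⟨p, rfl, rfl⟩ := h₁.of_far hik
      obtain ⟨q, hq, rfl⟩ := h₂.of_far hkj
      simp only [len_mul, len_s] at hw
      rcases ih _ _ _ _ (by omega) hq with ⟨rfl, rfl⟩ | ⟨hij, r, rfl, rfl⟩ | ⟨hij, r, rfl, rfl⟩
      · exact .inl ⟨rfl, rfl⟩
      · exact .inr (.inl ⟨hij, s k * r, far_comm hkj _, far_comm hik.symm _⟩)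
      · exact .inr (.inr ⟨hij, s k * r, by rw [far_comm hkj, far_comm hik.symm],
          by rw [far_comm hik.symm, far_comm hkj]⟩)
    · exact ih.trans_far_near hw hik hkj h₁ h₂
  · rcases eq_or_braidFar_or_braidNear k j with rfl | hkj | hkj
    · rwa [← h₂.eq]
    · exact (ih.trans_far_near hw hkj.symm hik.symm h₂.symm h₁.symm).symm
    · obtain ⟨p, rfl, rfl⟩ := h₁.of_near hik
      obtain ⟨q, hq, rfl⟩ := h₂.of_near hkj
      have hl := congrArg len hq
      simp only [len_mul, len_s] at hw hl
      have h := ih _ _ _ _ (by simp only [len_mul, len_s]; omega) hq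
      rcases eq_or_braidFar_or_braidNear i j with rfl | hij | hij
      · have h' := (ih _ _ _ _ (by omega) h.eq).eq
        exact .inl ⟨rfl, by rw [h']⟩
      · obtain ⟨r, hp, hr⟩ := h.of_far hij
        obtain ⟨b, rfl, rfl⟩ := (ih _ _ _ _ (by omega) hp).of_near hkj
        obtain ⟨c, rfl, hc⟩ := (ih _ _ _ _ (by omega) hr).of_near hik.symm
        have hl₂ := congrArg len hp
        have hl₃ := congrArg len hc
        simp only [len_mul, len_s] at hw hl hl₂ hl₃
        have hc' := (ih _ _ _ _ (by simp only [len_mul, len_s]; omega) hc).eq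
        obtain ⟨x, rfl, rfl⟩ := (ih _ _ _ _ (by omega) hc').of_far hij.symm
        refine .inr (.inl ⟨hij, s k * (s j * (s i * (s k * x))), ?_, ?_⟩)
        · rw [far_comm hij (s k * _), near_braid hik, near_braid hkj]
        · rw [far_comm hij.symm (s k * (s j * x)), near_braid hkj.symm, near_braid hik.symm,
            far_comm hij (s k * x)]
      · unfold BraidNear at *; omega

theorem headRel_of_conGen {L : ℕ} (ih : HeadRelBelow m L) {x y : FreeMonoid (Fin m)}
    (h : ConGen.Rel (BraidMonoidRel m) x y) (hx : len (PresentedMonoid.mk _ x) ≤ L + 1)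
    {i j : Fin m} {u v : FreeMonoid (Fin m)}
    (hi : x = FreeMonoid.of i * u) (hj : y = FreeMonoid.of j * v) :
    HeadRel i (PresentedMonoid.mk _ u) j (PresentedMonoid.mk _ v) := by
  induction h generalizing i j u v with
  | of x y h =>
    rcases h with ⟨a, b, h⟩ | ⟨a, b, h⟩
    · obtain ⟨rfl, rfl⟩ := List.cons_eq_cons.1 hi
      obtain ⟨rfl, rfl⟩ := List.cons_eq_cons.1 hj
      exact .inr (.inr ⟨h, 1, rfl, rfl⟩)
    · obtain ⟨rfl, rfl⟩ := List.cons_eq_cons.1 hi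
      obtain ⟨rfl, rfl⟩ := List.cons_eq_cons.1 hj
      exact .inr (.inl ⟨h, 1, rfl, rfl⟩)
  | refl x =>
    obtain ⟨rfl, rfl⟩ := List.cons_eq_cons.1 (hi.symm.trans hj)
    exact .inl ⟨rfl, rfl⟩
  | symm h ihh =>
    rw [← PresentedMonoid.mk_eq_mk_iff.2 h] at hx
    exact (ihh hx hj hi).symm
  | @trans x y z h₁ h₂ ih₁ ih₂ =>
    have e₁ := congrArg len (PresentedMonoid.mk_eq_mk_iff.2 h₁)
    have e₂ := congrArg len (PresentedMonoid.mk_eq_mk_iff.2 h₂)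
    subst hi hj
    cases y using FreeMonoid.casesOn with
    | one =>
      have := len_mk_of_mul i u
      simp only [map_one, len_one] at e₁
      omega
    | of_mul k w =>
      have := len_mk_of_mul i u
      have := len_mk_of_mul k w
      exact ih.trans (by omega) (ih₁ hx rfl rfl) (ih₂ (by omega) rfl rfl)
  | @mul w x y z h₁ h₂ ih₁ ih₂ =>
    have e₁ := congrArg len (PresentedMonoid.mk_eq_mk_iff.2 h₁)
    rw [map_mul, len_mul] at hx
    cases w using FreeMonoid.casesOn with
    | one =>
      cases x using FreeMonoid.casesOn with
      | one =>
        exact ih₂ (by omega) (by rwa [one_mul] at hi) (by rwa [one_mul] at hj)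
      | of_mul k x =>
        have := len_mk_of_mul k x
        simp only [map_one, len_one] at e₁
        omega
    | of_mul a w =>
      cases x using FreeMonoid.casesOn with
      | one =>
        have := len_mk_of_mul a w
        simp only [map_one, len_one] at e₁
        omega
      | of_mul b x =>
        rw [mul_assoc] at hi hj
        obtain ⟨rfl, rfl⟩ := List.cons_eq_cons.1 hi
        obtain ⟨rfl, rfl⟩ := List.cons_eq_cons.1 hj
        have e : PresentedMonoid.mk _ y = PresentedMonoid.mk _ z :=
          PresentedMonoid.mk_eq_mk_iff.2 h₂
        change HeadRel a (PresentedMonoid.mk _ (w * y)) b (PresentedMonoid.mk _ (x * z))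
        rw [map_mul, map_mul, ← e]
        exact (ih₁ (by omega) rfl rfl).mul_right _

theorem headRelBelow (m L : ℕ) : HeadRelBelow m L := by
  induction L with
  | zero => exact fun _ _ _ _ h => absurd h (Nat.not_lt_zero _)
  | succ L ih =>
    intro i j p q hp h
    obtain ⟨u, rfl⟩ := PresentedMonoid.surjective_mk p
    obtain ⟨v, rfl⟩ := PresentedMonoid.surjective_mk q
    refine headRel_of_conGen ih (x := FreeMonoid.of i * u) (y := FreeMonoid.of j * v)
      (PresentedMonoid.mk_eq_mk_iff.1 h) ?_ rfl rfl
    rw [len_mk_of_mul]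
    omega

/-- Two generators dividing the same element on the left: their least common multiple does too. -/
theorem headRel_of_mul_eq {i j : Fin m} {p q : BraidMonoid m} (h : s i * p = s j * q) :
    HeadRel i p j q :=
  headRelBelow m _ i j p q (Nat.lt_succ_self _) h

theorem s_mul_left_cancel {i : Fin m} {p q : BraidMonoid m} (h : s i * p = s i * q) : p = q :=
  (headRel_of_mul_eq h).eq

theorem mul_left_cancel' {x p q : BraidMonoid m} (h : x * p = x * q) : p = q := by
  induction x using induction_s with
  | one => simpa using h
  | s_mul i x ih => exact ih (s_mul_left_cancel (by simpa only [mul_assoc] using h))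

theorem eq_of_s_pow_eq {i j : Fin m} {k : ℕ} {v : BraidMonoid m} (h : s i ^ k = s j * v) :
    i = j := by
  induction k generalizing v with
  | zero =>
    have := congrArg len h
    simp only [pow_zero, len_one, len_mul, len_s] at this
    omega
  | succ k ih =>
    rw [pow_succ'] at h
    rcases headRel_of_mul_eq h with ⟨h, _⟩ | ⟨_, w, h, _⟩ | ⟨_, w, h, _⟩
    · exact h
    · exact ih h
    · exact ih h

theorem exists_of_s_pow_mul_eq {i j : Fin m} (hij : BraidNear i j) {k : ℕ} {x v : BraidMonoid m}
    (h : s i ^ (k + 1) * x = s j * v) : ∃ w, x = s j * (s i * w) := by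
  induction k generalizing v with
  | zero =>
    obtain ⟨w, h, _⟩ := (headRel_of_mul_eq (by simpa using h)).of_near hij
    exact ⟨w, h⟩
  | succ k ih =>
    rw [pow_succ', mul_assoc] at h
    obtain ⟨w, h, _⟩ := (headRel_of_mul_eq h).of_near hij
    exact ih h

theorem s_pow_mul_near {i j : Fin m} (hij : BraidNear i j) (k : ℕ) :
    SemiconjBy (s j * s i) (s j ^ k) (s i ^ k) := by
  refine SemiconjBy.pow_right ?_ k
  unfold SemiconjBy
  rw [mul_assoc, s_mul_s_mul_s hij.symm]

/-- An element conjugating a positive power of one generator to the same power of another one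
conjugates the generators themselves. -/
theorem semiconjBy_of_pow {i j : Fin m} {k : ℕ} {x : BraidMonoid m}
    (h : SemiconjBy x (s j ^ (k + 1)) (s i ^ (k + 1))) : SemiconjBy x (s j) (s i) := by
  induction hl : len x using Nat.strong_induction_on generalizing i x with
  | _ L ih =>
  subst hl
  cases x using induction_s with
  | one =>
    have h' : s i ^ (k + 1) = s j * s j ^ k := by
      simpa [SemiconjBy, pow_succ'] using h.symm
    rw [eq_of_s_pow_eq h']
    exact SemiconjBy.one_left _
  | s_mul a x _ =>
    rcases eq_or_braidFar_or_braidNear i a with rfl | hia | hia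
    · have h' : SemiconjBy x (s j ^ (k + 1)) (s i ^ (k + 1)) := by
        refine s_mul_left_cancel (i := i) ?_
        have := h.eq
        rw [← mul_assoc, this, ← mul_assoc, ← mul_assoc, ← pow_succ, ← pow_succ']
      exact SemiconjBy.mul_left (Commute.refl (s i)) (ih _ (by simp) h' rfl)
    · have hc : Commute (s a) (s i) := s_mul_s hia.symm
      have h' : SemiconjBy x (s j ^ (k + 1)) (s i ^ (k + 1)) := by
        refine s_mul_left_cancel (i := a) ?_
        rw [← mul_assoc, h.eq, ← mul_assoc, ← mul_assoc, (hc.pow_right _).eq]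
      exact SemiconjBy.mul_left hc (ih _ (by simp) h' rfl)
    · have h₁ := h.eq
      rw [mul_assoc] at h₁
      obtain ⟨y, hy⟩ := exists_of_s_pow_mul_eq hia h₁.symm
      obtain rfl := s_mul_left_cancel hy
      have h' : SemiconjBy y (s j ^ (k + 1)) (s a ^ (k + 1)) := by
        refine mul_left_cancel' (x := s a * s i) ?_
        have e := (s_pow_mul_near hia (k + 1)).eq
        rw [← mul_assoc _ (s a ^ _), e]
        simpa only [mul_assoc] using h.eq
      have h₂ := SemiconjBy.mul_left (by simpa using s_pow_mul_near hia 1)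
        (ih _ (by simp; omega) h' rfl)
      rwa [mul_assoc] at h₂

/-- The generators indexed by all natural numbers, with junk value `1` outside the range. -/
def gen (m k : ℕ) : BraidMonoid m := if h : k < m then s ⟨k, h⟩ else 1

theorem gen_val (i : Fin m) : gen m i = s i := by simp [gen]

theorem gen_comm {i j : ℕ} (hij : i + 2 ≤ j) (hj : j < m) : Commute (gen m i) (gen m j) := by
  simp only [gen, hj, show i < m by omega, dite_true]
  exact s_mul_s (.inl hij)

theorem gen_braid {i : ℕ} (hi : i + 1 < m) :
    gen m i * (gen m (i + 1) * gen m i) = gen m (i + 1) * (gen m i * gen m (i + 1)) := by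
  simp only [gen, hi, show i < m by omega, dite_true]
  exact s_mul_s_mul_s (.inl rfl)

/-- The product of the first `k` generators. -/
def partialδ (m : ℕ) : ℕ → BraidMonoid m
  | 0 => 1
  | k + 1 => partialδ m k * gen m k

theorem partialδ_comm {k l : ℕ} (hkl : k < l) (hl : l < m) :
    Commute (partialδ m k) (gen m l) := by
  induction k with
  | zero => exact Commute.one_left _
  | succ k ih => exact (ih (by omega)).mul_left (gen_comm (by omega) hl)

theorem partialδ_semiconjBy {i k : ℕ} (hik : i + 2 ≤ k) (hk : k ≤ m) :
    SemiconjBy (partialδ m k) (gen m i) (gen m (i + 1)) := by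
  induction k, hik using Nat.le_induction with
  | base =>
    have h := (partialδ_comm (m := m) (Nat.lt_succ_self i) (by omega)).eq
    change partialδ m i * gen m i * gen m (i + 1) * gen m i =
      gen m (i + 1) * (partialδ m i * gen m i * gen m (i + 1))
    simp only [mul_assoc, gen_braid (show i + 1 < m by omega)]
    simp only [← mul_assoc]
    rw [h]
  | succ k hik ih =>
    exact (ih (by omega)).mul_left (gen_comm (i := i) (by omega) (by omega)).symm

/-- The positive lift of the element `δ`. -/
def δ (m : ℕ) : BraidMonoid m := partialδ m m

theorem δ_semiconjBy {i : ℕ} (hi : i + 1 < m) : SemiconjBy (δ m) (gen m i) (gen m (i + 1)) :=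
  partialδ_semiconjBy hi le_rfl

theorem δ_pow_semiconjBy {i j : ℕ} (hij : i + j < m) :
    SemiconjBy (δ m ^ j) (gen m i) (gen m (i + j)) := by
  induction j with
  | zero => simp
  | succ j ih =>
    rw [pow_succ']
    exact (δ_semiconjBy (by omega)).mul_left (ih (by omega))

theorem gen_zero_mul_δ_mul_partialδ {k : ℕ} (hk : k < m) :
    gen m 0 * (δ m * partialδ m k) = partialδ m (k + 1) * δ m := by
  induction k with
  | zero => simp [partialδ]
  | succ k ih =>
    rw [partialδ, ← mul_assoc, ← mul_assoc, mul_assoc (gen m 0), ih (by omega), mul_assoc,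
      (δ_semiconjBy hk).eq, ← mul_assoc]
    rfl

theorem δ_sq_semiconjBy : SemiconjBy (δ (m + 1) ^ 2) (gen (m + 1) m) (gen (m + 1) 0) := by
  have h := gen_zero_mul_δ_mul_partialδ (Nat.lt_succ_self m)
  have hδ : δ (m + 1) = partialδ (m + 1) m * gen (m + 1) m := rfl
  change δ (m + 1) ^ 2 * gen (m + 1) m = gen (m + 1) 0 * δ (m + 1) ^ 2
  calc _ = partialδ (m + 1) (m + 1) * δ (m + 1) * gen (m + 1) m := by rw [sq]; rfl
    _ = gen (m + 1) 0 * (δ (m + 1) * (partialδ (m + 1) m * gen (m + 1) m)) := by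
      rw [← h]
      simp only [mul_assoc]
    _ = _ := by rw [← hδ, sq]

/-- The positive lift of the full twist. -/
def twist (m : ℕ) : BraidMonoid m := δ m ^ (m + 1)

theorem twist_comm_s (i : Fin m) : Commute (twist m) (s i) := by
  obtain ⟨m, rfl⟩ : ∃ l, m = l + 1 := ⟨m - 1, by have := i.isLt; omega⟩
  have hi : (i : ℕ) ≤ m := by omega
  have h₁ : SemiconjBy (δ (m + 1) ^ (m - i)) (gen (m + 1) i) (gen (m + 1) m) := by
    simpa [hi] using δ_pow_semiconjBy (m := m + 1) (i := i) (j := m - i) (by omega)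
  have h₂ : SemiconjBy (δ (m + 1) ^ (i : ℕ)) (gen (m + 1) 0) (gen (m + 1) i) := by
    simpa using δ_pow_semiconjBy (m := m + 1) (i := 0) (j := i) (by omega)
  have h := h₂.mul_left (δ_sq_semiconjBy.mul_left h₁)
  rw [← pow_add, ← pow_add, gen_val] at h
  rwa [show (i : ℕ) + (2 + (m - i)) = m + 1 + 1 by omega] at h

theorem twist_comm (x : BraidMonoid m) : Commute (twist m) x := by
  induction x using induction_s with
  | one => exact Commute.one_right _
  | s_mul i x ih => exact (twist_comm_s i).mul_right ih

theorem exists_partialδ_eq (m k : ℕ) : ∃ r, partialδ m (k + 1) = gen m 0 * r := by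
  induction k with
  | zero => exact ⟨1, by simp [partialδ]⟩
  | succ k ih =>
    obtain ⟨r, hr⟩ := ih
    exact ⟨r * gen m (k + 1), by rw [partialδ, hr, mul_assoc]⟩

theorem exists_s_mul_eq_twist (i : Fin m) : ∃ d, s i * d = twist m := by
  obtain ⟨m, rfl⟩ : ∃ l, m = l + 1 := ⟨m - 1, by have := i.isLt; omega⟩
  obtain ⟨r, hr⟩ := exists_partialδ_eq (m + 1) m
  have h : SemiconjBy (δ (m + 1) ^ (i : ℕ)) (gen (m + 1) 0) (gen (m + 1) i) := by
    simpa using δ_pow_semiconjBy (m := m + 1) (i := 0) (j := i) (by omega)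
  refine ⟨δ (m + 1) ^ (i : ℕ) * r * δ (m + 1) ^ (m + 1 - i), ?_⟩
  rw [← gen_val, ← mul_assoc, ← mul_assoc, ← h.eq, mul_assoc (δ (m + 1) ^ _), ← hr]
  change δ (m + 1) ^ (i : ℕ) * δ (m + 1) * _ = _
  rw [← pow_succ, ← pow_add, twist]
  congr 1
  omega

theorem exists_mul_eq_twist_pow (x : BraidMonoid m) : ∃ y l, x * y = twist m ^ l := by
  induction x using induction_s with
  | one => exact ⟨1, 0, by simp⟩
  | s_mul i x ih =>
    obtain ⟨y, l, h⟩ := ih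
    obtain ⟨d, hd⟩ := exists_s_mul_eq_twist i
    refine ⟨y * d, l + 1, ?_⟩
    rw [mul_assoc, ← mul_assoc x, h, ((twist_comm d).pow_left l).eq, ← mul_assoc, hd, pow_succ']

theorem commute_of_mem_powers_twist (d : Submonoid.powers (twist m)) (x : BraidMonoid m) :
    Commute (d : BraidMonoid m) x := by
  obtain ⟨_, l, rfl⟩ := d
  exact (twist_comm x).pow_left l

instance : OreLocalization.OreSet (Submonoid.powers (twist m)) where
  ore_right_cancel r₁ r₂ d h := ⟨d, by
    rwa [(commute_of_mem_powers_twist d r₁).eq, (commute_of_mem_powers_twist d r₂).eq]⟩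
  oreNum r _ := r
  oreDenom _ d := d
  ore_eq r d := (commute_of_mem_powers_twist d r).eq

/-- The monoid of fractions obtained by inverting the positive full twist. -/
abbrev Fractions (m : ℕ) : Type :=
  OreLocalization (Submonoid.powers (twist m)) (BraidMonoid m)

/-- The canonical map of the positive braid monoid to its monoid of fractions. -/
def toFractions (m : ℕ) : BraidMonoid m →* Fractions m := OreLocalization.numeratorHom

theorem toFractions_injective (m : ℕ) : Function.Injective (toFractions m) := by
  intro x y h
  obtain ⟨u, v, h₁, h₂⟩ := OreLocalization.oreDiv_eq_iff.1 h
  have huv : (u : BraidMonoid m) = v := by simpa using h₂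
  rw [← huv] at h₁
  exact (mul_left_cancel' h₁).symm

theorem isUnit_toFractions_s (i : Fin m) : IsUnit (toFractions m (s i)) := by
  obtain ⟨d, hd⟩ := exists_s_mul_eq_twist i
  have hd' : d * s i = twist m := by
    refine s_mul_left_cancel (i := i) ?_
    rw [← mul_assoc, hd, (twist_comm_s i).eq]
  obtain ⟨U, hU⟩ : IsUnit (toFractions m (twist m)) :=
    OreLocalization.numerator_isUnit ⟨twist m, Submonoid.mem_powers _⟩
  refine isUnit_iff_exists_and_exists.2
    ⟨⟨toFractions m d * ↑U⁻¹, ?_⟩, ↑U⁻¹ * toFractions m d, ?_⟩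
  · rw [← mul_assoc, ← map_mul, hd, ← hU, Units.mul_inv]
  · rw [mul_assoc, ← map_mul, hd', ← hU, Units.inv_mul]

/-- The canonical map of the positive braid monoid to the group with the same presentation. -/
def toGroup (m : ℕ) : BraidMonoid m →* PresentedGroup (braidRels m) :=
  PresentedMonoid.lift (fun i => PresentedGroup.of i) (by
    have hb {i j : Fin m} (h : (i : ℕ) + 1 = j) :
        (PresentedGroup.of i * PresentedGroup.of j * PresentedGroup.of i :
          PresentedGroup (braidRels m)) =
        PresentedGroup.of j * PresentedGroup.of i * PresentedGroup.of j :=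
      PresentedGroup.mk_eq_mk_of_mul_inv_mem ⟨i, j, .inl ⟨h, rfl⟩⟩
    have hc {i j : Fin m} (h : (i : ℕ) + 2 ≤ j) :
        (PresentedGroup.of i * PresentedGroup.of j : PresentedGroup (braidRels m)) =
        PresentedGroup.of j * PresentedGroup.of i :=
      PresentedGroup.mk_eq_mk_of_mul_inv_mem ⟨i, j, .inr ⟨h, rfl⟩⟩
    rintro _ _ (⟨i, j, h | h⟩ | ⟨i, j, h | h⟩)
    · exact hb h
    · exact (hb h).symm
    · exact hc h
    · exact (hc h).symm)

theorem toGroup_s (i : Fin m) : toGroup m (s i) = PresentedGroup.of i := rfl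

/-- The homomorphism from the braid group to the units of the fractions of the positive monoid. -/
noncomputable def groupToFractions (m : ℕ) : PresentedGroup (braidRels m) →* (Fractions m)ˣ :=
  PresentedGroup.toGroup (f := fun i => (isUnit_toFractions_s i).unit) (by
    rintro _ ⟨i, j, ⟨h, rfl⟩ | ⟨h, rfl⟩⟩
    · rw [map_mul, map_inv, mul_inv_eq_one]
      ext
      simp only [map_mul, FreeGroup.lift_apply_of, Units.val_mul, IsUnit.unit_spec]
      simp only [← map_mul, mul_assoc, s_mul_s_mul_s (show BraidNear i j from .inl h)]
    · rw [map_mul, map_inv, mul_inv_eq_one]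
      ext
      simp only [map_mul, FreeGroup.lift_apply_of, Units.val_mul, IsUnit.unit_spec]
      simp only [← map_mul, s_mul_s (show BraidFar i j from .inl h)])

theorem groupToFractions_toGroup (x : BraidMonoid m) :
    (groupToFractions m (toGroup m x) : Fractions m) = toFractions m x := by
  induction x using induction_s with
  | one => simp
  | s_mul i x ih =>
    rw [map_mul, map_mul, map_mul, Units.val_mul, ih, toGroup_s, groupToFractions,
      PresentedGroup.toGroup.of, IsUnit.unit_spec]

/-- The positive braid monoid embeds in the braid group. -/
theorem toGroup_injective (m : ℕ) : Function.Injective (toGroup m) := by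
  intro x y h
  apply toFractions_injective
  rw [← groupToFractions_toGroup, h, groupToFractions_toGroup]

theorem toGroup_twist_comm (g : PresentedGroup (braidRels m)) :
    Commute (toGroup m (twist m)) g := by
  have h := PresentedGroup.generated_by _ (Subgroup.centralizer {toGroup m (twist m)}) (fun i => by
    rw [Subgroup.mem_centralizer_singleton_iff]
    exact (((twist_comm_s i).map (toGroup m)).eq).symm) g
  exact (Subgroup.mem_centralizer_singleton_iff.1 h).symm

/-- Every braid becomes positive after multiplication by a power of the full twist. -/
theorem exists_twist_pow_mul_eq (g : PresentedGroup (braidRels m)) :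
    ∃ l x, toGroup m (twist m) ^ l * g = toGroup m x := by
  let H : Subgroup (PresentedGroup (braidRels m)) :=
    { carrier := {g | ∃ l x, toGroup m (twist m) ^ l * g = toGroup m x}
      one_mem' := ⟨0, 1, by simp⟩
      mul_mem' := by
        rintro g h ⟨k, x, hx⟩ ⟨l, y, hy⟩
        refine ⟨k + l, x * y, ?_⟩
        rw [map_mul, ← hx, ← hy, pow_add, mul_assoc, mul_assoc, ← mul_assoc _ g,
          ((toGroup_twist_comm g).pow_left l).eq, mul_assoc]
      inv_mem' := by
        rintro g ⟨k, x, hx⟩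
        obtain ⟨y, l, hy⟩ := exists_mul_eq_twist_pow x
        refine ⟨l, y * twist m ^ k, ?_⟩
        have hg : g⁻¹ = (toGroup m x)⁻¹ * toGroup m (twist m) ^ k := by
          rw [← hx, mul_inv_rev, inv_mul_cancel_right]
        have hy' : toGroup m y = (toGroup m x)⁻¹ * toGroup m (twist m) ^ l := by
          rw [← map_pow, ← hy, map_mul, inv_mul_cancel_left]
        rw [map_mul, map_pow, hy', hg, ← mul_assoc,
          ((toGroup_twist_comm (toGroup m x)⁻¹).pow_left l).eq] }
  exact PresentedGroup.generated_by _ H (fun i => ⟨0, s i, by simp [toGroup_s]⟩) g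

theorem commute_of_commute_pow {i : Fin m} {k : ℕ} {g : PresentedGroup (braidRels m)}
    (h : Commute g (PresentedGroup.of i ^ (k + 1))) : Commute g (PresentedGroup.of i) := by
  obtain ⟨l, x, hx⟩ := exists_twist_pow_mul_eq g
  have h' := ((toGroup_twist_comm _).pow_left l).mul_left h
  rw [hx, ← toGroup_s] at h'
  have hx' : Commute x (s i) := by
    refine semiconjBy_of_pow (k := k) (toGroup_injective m ?_)
    simpa only [map_mul, map_pow] using h'.eq
  have hg : g = (toGroup m (twist m) ^ l)⁻¹ * toGroup m x := by
    rw [← hx, inv_mul_cancel_left]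
  rw [hg, ← toGroup_s]
  exact ((toGroup_twist_comm _).pow_left l).inv_left.mul_left (hx'.map (toGroup m))

theorem commute_of_commute_zpow {i : Fin m} {k : ℤ} (hk : k ≠ 0)
    {g : PresentedGroup (braidRels m)} (h : Commute g (PresentedGroup.of i ^ k)) :
    Commute g (PresentedGroup.of i) := by
  obtain ⟨l, rfl | rfl⟩ : ∃ l : ℕ, k = (l + 1 : ℕ) ∨ k = -(l + 1 : ℕ) :=
    ⟨k.natAbs - 1, by omega⟩
  · exact commute_of_commute_pow (by rwa [zpow_natCast] at h)
  · exact commute_of_commute_pow (by rwa [zpow_neg, Commute.inv_right_iff, zpow_natCast] at h)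

theorem commute_of_isConj_of_commute_zpow {i : Fin m} {k : ℤ} (hk : k ≠ 0)
    {g a : PresentedGroup (braidRels m)} (ha : IsConj (PresentedGroup.of i) a)
    (h : Commute g (a ^ k)) : Commute g a := by
  obtain ⟨c, rfl⟩ := isConj_iff.1 ha
  rw [conj_zpow] at h
  have h' := (Commute.conj_iff c⁻¹).2 h
  rw [← Commute.conj_iff c⁻¹]
  simp only [mul_assoc, inv_inv, inv_mul_cancel_left, inv_mul_cancel, mul_one] at h' ⊢
  exact commute_of_commute_zpow hk h'

end BraidMonoid

/-- For `n ≥ 4`, half-twists `a, b` in `B_n`, and nonzero integers `j, k`,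
the powers `a^j` and `b^k` commute iff `a` and `b` commute. -/
theorem braidGroup_halfTwist_commute_powers (n : ℕ) (hn : 4 ≤ n)
    (a b : BraidGroup n)
    (ha : IsConj (braidσ n ⟨0, by omega⟩) a)
    (hb : IsConj (braidσ n ⟨0, by omega⟩) b)
    (j k : ℤ) (hj : j ≠ 0) (hk : k ≠ 0) :
    Commute (a ^ j) (b ^ k) ↔ Commute a b := by
  refine ⟨fun h => ?_, fun h => h.zpow_zpow j k⟩
  have h₁ := BraidMonoid.commute_of_isConj_of_commute_zpow hk hb h
  exact (BraidMonoid.commute_of_isConj_of_commute_zpow hj ha h₁.symm).symm
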